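/- Let B be an associative unital k-algebra, W a k-vector space with distinguished element 1_W, and let P: B⊗W → W⊗B and ν: W⊗W → W⊗B satisfy the mirror Brzeziński crossed product conditions. Then the linear maps J = P, T = id, γ: W⊗W → W⊗W⊗B, γ(w⊗w') = w⊗w'⊗1_B, and η: W⊗W → W⊗B⊗B, η(w⊗w') = ν₁(w,w')⊗ν₂(w,w')⊗1_B, satisfy the L-R-crossed product axioms (1)-(13) (with U = W, 1_U = 1_W, and B playing the role of H). -/

import Mathlib

open TensorProduct LinearMap

noncomputable section

variable {k : Type*} [Field k]

section Helpers

variable {M N P Q : Type*}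
  [AddCommMonoid M] [AddCommMonoid N] [AddCommMonoid P] [AddCommMonoid Q]
  [Module k M] [Module k N] [Module k P] [Module k Q]

def aso : (M ⊗[k] N) ⊗[k] P →ₗ[k] M ⊗[k] (N ⊗[k] P) :=
  (TensorProduct.assoc k M N P).toLinearMap

def osa : M ⊗[k] (N ⊗[k] P) →ₗ[k] (M ⊗[k] N) ⊗[k] P :=
  (TensorProduct.assoc k M N P).symm.toLinearMap

def cc : M ⊗[k] N →ₗ[k] N ⊗[k] M := (TensorProduct.comm k M N).toLinearMap

def lc : M ⊗[k] (N ⊗[k] P) →ₗ[k] N ⊗[k] (M ⊗[k] P) :=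
  (TensorProduct.leftComm k M N P).toLinearMap

def tt : (M ⊗[k] N) ⊗[k] (P ⊗[k] Q) →ₗ[k] (M ⊗[k] P) ⊗[k] (N ⊗[k] Q) :=
  (TensorProduct.tensorTensorTensorComm k M N P Q).toLinearMap

end Helpers

section LRCrossed

variable (k)
variable (H U : Type*) [Ring H] [Algebra k H] [AddCommGroup U] [Module k U]

abbrev mH : H ⊗[k] H →ₗ[k] H := LinearMap.mul' k H

def dR : (H ⊗[k] H) ⊗[k] H →ₗ[k] H ⊗[k] H :=
  rTensor H (mH k H) ∘ₗ osa ∘ₗ lTensor H cc ∘ₗ aso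

/-- `d ⊗ (g ⊗ i) ↦ (d*g) ⊗ i`. -/
def dL : H ⊗[k] (H ⊗[k] H) →ₗ[k] H ⊗[k] H :=
  rTensor H (mH k H) ∘ₗ osa

/-- `(g ⊗ i) ⊗ d ↦ g ⊗ (d*i)`. -/
def eR : (H ⊗[k] H) ⊗[k] H →ₗ[k] H ⊗[k] H :=
  lTensor H ((mH k H) ∘ₗ cc) ∘ₗ aso

/-- `d ⊗ (g ⊗ i) ↦ g ⊗ (i*d)`. -/
def eL : H ⊗[k] (H ⊗[k] H) →ₗ[k] H ⊗[k] H :=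
  lTensor H ((mH k H) ∘ₗ cc) ∘ₗ lc

/-- `(g ⊗ i) ⊗ (a ⊗ b) ↦ (g*a) ⊗ (b*i)`. -/
def mulLR : (H ⊗[k] H) ⊗[k] (H ⊗[k] H) →ₗ[k] H ⊗[k] H :=
  TensorProduct.map (mH k H) ((mH k H) ∘ₗ cc) ∘ₗ tt


def w12 : H ⊗[k] (H ⊗[k] H) →ₗ[k] H ⊗[k] H :=
  lTensor H ((mH k H) ∘ₗ cc) ∘ₗ lc ∘ₗ lTensor H cc

def inner12 : (H ⊗[k] H) ⊗[k] (H ⊗[k] H) →ₗ[k] H ⊗[k] H :=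
  lTensor H ((mH k H) ∘ₗ cc) ∘ₗ aso ∘ₗ lTensor (H ⊗[k] H) ((mH k H) ∘ₗ cc)

/-- `(g ⊗ i) ⊗ (b ⊗ (d ⊗ e)) ↦ g * d * e * b * i`. -/
def omegaM : (H ⊗[k] H) ⊗[k] (H ⊗[k] (H ⊗[k] H)) →ₗ[k] H :=
  (mH k H) ∘ₗ
    TensorProduct.map (mH k H) ((mH k H) ∘ₗ rTensor H (mH k H) ∘ₗ cc) ∘ₗ
    tt ∘ₗ lTensor (H ⊗[k] H) (lTensor H cc ∘ₗ lc)

variable {H U}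
variable (J : H ⊗[k] U →ₗ[k] U ⊗[k] H) (T : U ⊗[k] H →ₗ[k] U ⊗[k] H)
variable (γ : U ⊗[k] U →ₗ[k] U ⊗[k] (U ⊗[k] H))
variable (η : U ⊗[k] U →ₗ[k] U ⊗[k] (H ⊗[k] H))

variable (oneU : U)

/-- Axiom (1): `J(h ⊗ 1_U) = 1_U ⊗ h` and `J(1_H ⊗ u) = u ⊗ 1_H`. -/
def LRax1 : Prop :=
  (∀ h : H, J (h ⊗ₜ oneU) = oneU ⊗ₜ h) ∧ (∀ u : U, J ((1 : H) ⊗ₜ u) = u ⊗ₜ (1 : H))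

/-- Axiom (2): `T(u ⊗ 1_H) = u ⊗ 1_H` and `T(1_U ⊗ h) = 1_U ⊗ h`. -/
def LRax2 : Prop :=
  (∀ u : U, T (u ⊗ₜ (1 : H)) = u ⊗ₜ (1 : H)) ∧ (∀ h : H, T (oneU ⊗ₜ h) = oneU ⊗ₜ h)

/-- Axiom (3): `γ(u ⊗ 1_U) = u ⊗ 1_U ⊗ 1_H` and `γ(1_U ⊗ u) = 1_U ⊗ u ⊗ 1_H`. -/
def LRax3 : Prop :=
  (∀ u : U, γ (u ⊗ₜ oneU) = u ⊗ₜ (oneU ⊗ₜ (1 : H))) ∧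
  (∀ u : U, γ (oneU ⊗ₜ u) = oneU ⊗ₜ (u ⊗ₜ (1 : H)))

/-- Axiom (4): `η(u ⊗ 1_U) = η(1_U ⊗ u) = u ⊗ 1_H ⊗ 1_H`. -/
def LRax4 : Prop :=
  (∀ u : U, η (u ⊗ₜ oneU) = u ⊗ₜ ((1 : H) ⊗ₜ (1 : H))) ∧
  (∀ u : U, η (oneU ⊗ₜ u) = u ⊗ₜ ((1 : H) ⊗ₜ (1 : H)))

/-- Axiom (5): `u_J ⊗ (hh')_J = (u_J)_j ⊗ h_j h'_J`. -/
def LRax5 : Prop := ∀ (h h' : H) (u : U),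
  J ((h * h') ⊗ₜ u) =
    lTensor U (mH k H) (aso (rTensor H J (osa (h ⊗ₜ (J (h' ⊗ₜ u))))))

/-- Axiom (6): `u_T ⊗ (hh')_T = (u_T)_t ⊗ h_T h'_t`. -/
def LRax6 : Prop := ∀ (u : U) (h h' : H),
  T (u ⊗ₜ (h * h')) =
    lTensor U ((mH k H) ∘ₗ cc)
      (aso (rTensor H T (osa (lTensor U cc (aso ((T (u ⊗ₜ h)) ⊗ₜ h'))))))

/-- Axiom (7):
`η₁(u_J,u'_j) ⊗ η₂(u_J,u'_j)(h_J)_j ⊗ η₃(u_J,u'_j) = η₁(u,u')_J ⊗ h_J η₂(u,u') ⊗ η₃(u,u')`. -/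
def LRax7 : Prop := ∀ (h : H) (u u' : U),
  lTensor U (dR k H)
      (aso (rTensor H η (osa (lTensor U J (aso ((J (h ⊗ₜ u)) ⊗ₜ u'))))))
  = lTensor U (dL k H)
      (aso (rTensor (H ⊗[k] H) J (osa (h ⊗ₜ (η (u ⊗ₜ u'))))))

/-- Axiom (8):
`η₁(u_t,u'_T) ⊗ η₂(u_t,u'_T) ⊗ (h_T)_t η₃(u_t,u'_T) = η₁(u,u')_T ⊗ η₂(u,u') ⊗ η₃(u,u')h_T`. -/
def LRax8 : Prop := ∀ (u u' : U) (h : H),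
  lTensor U (eR k H)
      (aso (rTensor H η (osa (lTensor U cc
        (aso (rTensor U T (osa (lTensor U cc (u ⊗ₜ (T (u' ⊗ₜ h)))))))))))
  = lTensor U (eL k H)
      (aso (rTensor (H ⊗[k] H) T (osa (lTensor U cc (aso ((η (u ⊗ₜ u')) ⊗ₜ h))))))

/-- Axiom (9). -/
def LRax9 : Prop := ∀ (u u' u'' : U),
  lTensor U (mulLR k H)
      (aso (rTensor (H ⊗[k] H) η (osa (lTensor U (aso (P := H))
        ((lTensor U (rTensor H J ∘ₗ osa ∘ₗ lTensor H cc ∘ₗ aso))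
          (aso ((η (u ⊗ₜ u')) ⊗ₜ u'')))))))
  = lTensor U ((mulLR k H) ∘ₗ lTensor (H ⊗[k] H) cc)
      (aso (rTensor (H ⊗[k] H) η (tt (rTensor (U ⊗[k] H) T
        (osa (lTensor U (lc ∘ₗ lTensor U cc) (u ⊗ₜ (η (u' ⊗ₜ u'')))))))))


def qJ : (U ⊗[k] H) ⊗[k] H →ₗ[k] U ⊗[k] H :=
  lTensor U (mH k H) ∘ₗ aso ∘ₗ rTensor H J ∘ₗ osa ∘ₗ lc ∘ₗ lTensor U cc ∘ₗ aso

/-- Axiom (10). -/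
def LRax10 : Prop := ∀ (u u' : U) (h : H),
  lTensor U (lTensor U ((mH k H) ∘ₗ cc))
      (aso (tt (rTensor (U ⊗[k] H) T (osa (lTensor U cc
        (aso (rTensor H γ (osa (u ⊗ₜ (J (h ⊗ₜ u')))))))))))
  = lTensor U (qJ k J)
      (aso (rTensor H γ (osa (lTensor U cc (aso ((T (u ⊗ₜ h)) ⊗ₜ u'))))))

def psi11 : (U ⊗[k] H) ⊗[k] (H ⊗[k] H) →ₗ[k] U ⊗[k] (H ⊗[k] H) :=
  lTensor U (rTensor H (mH k H) ∘ₗ osa) ∘ₗ aso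

def chainX : (U ⊗[k] H) ⊗[k] (U ⊗[k] H) →ₗ[k] U ⊗[k] (H ⊗[k] H) :=
  (lTensor U ((dR k H) ∘ₗ lTensor (H ⊗[k] H) (mH k H))) ∘ₗ aso ∘ₗ
    rTensor (H ⊗[k] H) η ∘ₗ rTensor (H ⊗[k] H) cc ∘ₗ tt ∘ₗ
    lTensor (U ⊗[k] H) cc ∘ₗ rTensor (H ⊗[k] U) J ∘ₗ rTensor (H ⊗[k] U) cc ∘ₗ
    tt ∘ₗ lTensor (U ⊗[k] H) cc

/-- Axiom (11). -/
def LRax11 : Prop := ∀ (u u' u'' : U),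
  lTensor U (psi11 k)
      (aso (tt (rTensor ((U ⊗[k] H) ⊗[k] H) T (tt (rTensor (H ⊗[k] H) γ
        (osa (u ⊗ₜ (η (u' ⊗ₜ u'')))))))))
  = lTensor U (chainX k J η)
      (aso (rTensor (U ⊗[k] H) γ (osa (lTensor U cc
        (aso ((γ (u ⊗ₜ u')) ⊗ₜ u''))))))

def chain12 : (U ⊗[k] H) ⊗[k] (H ⊗[k] H) →ₗ[k] U ⊗[k] (H ⊗[k] H) :=
  (lTensor U (w12 k H)) ∘ₗ aso ∘ₗ tt ∘ₗ rTensor (H ⊗[k] H) J ∘ₗ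
    rTensor (H ⊗[k] H) cc ∘ₗ tt ∘ₗ lTensor (U ⊗[k] H) cc

def big12 : (H ⊗[k] H) ⊗[k] (H ⊗[k] (U ⊗[k] H)) →ₗ[k] U ⊗[k] (H ⊗[k] H) :=
  lTensor U (inner12 k H) ∘ₗ lc ∘ₗ lTensor (H ⊗[k] H) lc

/-- Axiom (12). -/
def LRax12 : Prop := ∀ (u u' u'' : U),
  lTensor U (chain12 k J)
      (aso (rTensor (H ⊗[k] H) γ (osa (lTensor U cc
        (aso ((η (u ⊗ₜ u')) ⊗ₜ u''))))))
  = lTensor U (big12 k)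
      (aso (rTensor (H ⊗[k] (U ⊗[k] H)) η (tt (lTensor (U ⊗[k] H) cc
        (rTensor ((U ⊗[k] H) ⊗[k] U) T (tt (lTensor (U ⊗[k] (U ⊗[k] H)) cc
          (rTensor (U ⊗[k] H) γ (osa (lTensor U lc (u ⊗ₜ (γ (u' ⊗ₜ u'')))))))))))))

def w13 : H ⊗[k] (U ⊗[k] H) →ₗ[k] U ⊗[k] H :=
  lTensor U ((mH k H) ∘ₗ cc) ∘ₗ lc

def xi2 : H ⊗[k] (U ⊗[k] H) →ₗ[k] U ⊗[k] H :=
  lTensor U (mH k H) ∘ₗ aso ∘ₗ rTensor H J ∘ₗ osa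

def xi : H ⊗[k] (U ⊗[k] (U ⊗[k] H)) →ₗ[k] U ⊗[k] (U ⊗[k] H) :=
  lTensor U (xi2 k J) ∘ₗ lc

def rho : (U ⊗[k] H) ⊗[k] U →ₗ[k] (U ⊗[k] (U ⊗[k] H)) ⊗[k] H :=
  rTensor H γ ∘ₗ osa ∘ₗ lTensor U cc ∘ₗ aso

def chainR : ((U ⊗[k] (U ⊗[k] H)) ⊗[k] H) ⊗[k] H →ₗ[k] (U ⊗[k] H) ⊗[k] (U ⊗[k] H) :=
  tt ∘ₗ lTensor (U ⊗[k] U) cc ∘ₗ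
    lTensor (U ⊗[k] U) (rTensor H ((mH k H) ∘ₗ cc) ∘ₗ osa) ∘ₗ tt ∘ₗ
    lTensor (U ⊗[k] H) aso ∘ₗ rTensor ((U ⊗[k] H) ⊗[k] H) T ∘ₗ tt ∘ₗ
    lTensor (U ⊗[k] (U ⊗[k] H)) cc ∘ₗ aso

/-- The composite computing the right-hand side of axiom (13). -/
def rhs13 : ((H ⊗[k] (U ⊗[k] U)) ⊗[k] U) ⊗[k] H →ₗ[k]
    (U ⊗[k] (U ⊗[k] H)) ⊗[k] (U ⊗[k] H) :=
  osa ∘ₗ lTensor U (chainR k T) ∘ₗ aso ∘ₗ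
    rTensor H (lTensor U (rho k γ) ∘ₗ aso ∘ₗ rTensor U ((xi k J) ∘ₗ lTensor H γ))

/-- Axiom (13). -/
def LRax13 : Prop := ∀ (u u' u'' : U) (h h' : H),
  rTensor (U ⊗[k] H) (xi k J)
      (osa (h' ⊗ₜ (lTensor (U ⊗[k] (U ⊗[k] H)) (w13 k)
        (aso (rTensor (U ⊗[k] H) (rTensor H γ) (rTensor (U ⊗[k] H) osa
          (osa (u ⊗ₜ (rTensor (U ⊗[k] H) T (osa (lTensor U cc
            (aso ((γ (u' ⊗ₜ u'')) ⊗ₜ h)))))))))))))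
  = rhs13 k J T γ (((h' ⊗ₜ (u ⊗ₜ u')) ⊗ₜ u'') ⊗ₜ h)

/-- The L-R-crossed product multiplication, as a linear map. -/
def lrM : (U ⊗[k] H) ⊗[k] (U ⊗[k] H) →ₗ[k] U ⊗[k] H :=
  lTensor U (omegaM k H) ∘ₗ aso ∘ₗ rTensor (H ⊗[k] (H ⊗[k] H)) η ∘ₗ tt ∘ₗ
    lTensor (U ⊗[k] H) aso ∘ₗ rTensor ((U ⊗[k] H) ⊗[k] H) T ∘ₗ tt ∘ₗ
    lTensor (U ⊗[k] (U ⊗[k] H)) cc ∘ₗ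
    rTensor (H ⊗[k] H) (lTensor U J ∘ₗ lTensor U cc ∘ₗ aso) ∘ₗ tt ∘ₗ
    rTensor (H ⊗[k] H) (osa ∘ₗ γ) ∘ₗ tt

/-- The L-R-crossed product multiplication of two elements of `U ⊗ H`. -/
def lrMul (x y : U ⊗[k] H) : U ⊗[k] H := lrM k J T γ η (x ⊗ₜ y)

end LRCrossed


section Mirror

variable {k : Type*} [Field k]
variable {B W : Type*} [Ring B] [Algebra k B] [AddCommGroup W] [Module k W] (oneW : W)
variable (P : B ⊗[k] W →ₗ[k] W ⊗[k] B) (ν : W ⊗[k] W →ₗ[k] W ⊗[k] B)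

/-- The conditions defining a mirror version `W ⊗̄_{P,ν} B` of the Brzeziński crossed
product. -/
structure IsMirrorBrzezinskiCrossedProduct : Prop where
  P_one : ∀ b : B, P (b ⊗ₜ oneW) = oneW ⊗ₜ b
  one_P : ∀ w : W, P ((1 : B) ⊗ₜ w) = w ⊗ₜ (1 : B)
  nu_one : ∀ w : W, ν (w ⊗ₜ oneW) = w ⊗ₜ (1 : B)
  one_nu : ∀ w : W, ν (oneW ⊗ₜ w) = w ⊗ₜ (1 : B)
  P_mul : ∀ (w : W) (b b' : B),
    P ((b * b') ⊗ₜ w) =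
      lTensor W (LinearMap.mul' k B) (aso (rTensor B P (osa (b ⊗ₜ (P (b' ⊗ₜ w))))))
  compat : ∀ (w w' : W) (b : B),
    lTensor W (LinearMap.mul' k B) (aso (rTensor B ν
        (osa (lTensor W P (aso ((P (b ⊗ₜ w)) ⊗ₜ w')))))) =
      lTensor W (LinearMap.mul' k B) (aso (rTensor B P (osa (b ⊗ₜ (ν (w ⊗ₜ w'))))))
  cocycle : ∀ (w w' w'' : W),
    lTensor W (LinearMap.mul' k B) (aso (rTensor B ν
        (osa (lTensor W P (aso ((ν (w ⊗ₜ w')) ⊗ₜ w'')))))) =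
      lTensor W (LinearMap.mul' k B) (aso (rTensor B ν (osa (w ⊗ₜ (ν (w' ⊗ₜ w''))))))

end Mirror


section PureTensors

variable {M N P Q : Type*}
  [AddCommMonoid M] [AddCommMonoid N] [AddCommMonoid P] [AddCommMonoid Q]
  [Module k M] [Module k N] [Module k P] [Module k Q]

@[simp]
theorem aso_tmul (m : M) (n : N) (p : P) :
    aso (k := k) ((m ⊗ₜ n) ⊗ₜ p) = m ⊗ₜ (n ⊗ₜ p) := rfl

@[simp]
theorem osa_tmul (m : M) (n : N) (p : P) :
    osa (k := k) (m ⊗ₜ (n ⊗ₜ p)) = (m ⊗ₜ n) ⊗ₜ p := rfl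

@[simp]
theorem cc_tmul (m : M) (n : N) : cc (k := k) (m ⊗ₜ n) = n ⊗ₜ m := rfl

@[simp]
theorem lc_tmul (m : M) (n : N) (p : P) :
    lc (k := k) (m ⊗ₜ (n ⊗ₜ p)) = n ⊗ₜ (m ⊗ₜ p) := rfl

@[simp]
theorem tt_tmul (m : M) (n : N) (p : P) (q : Q) :
    tt (k := k) ((m ⊗ₜ n) ⊗ₜ (p ⊗ₜ q)) = (m ⊗ₜ p) ⊗ₜ (n ⊗ₜ q) := rfl

end PureTensors

section MirrorToLR

variable {k : Type*} [Field k] {B W : Type*} [Ring B] [Algebra k B]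
  [AddCommGroup W] [Module k W] {oneW : W}
  {P : B ⊗[k] W →ₗ[k] W ⊗[k] B} {ν : W ⊗[k] W →ₗ[k] W ⊗[k] B}

variable (k B W) in
/-- `w ⊗ w' ↦ w ⊗ (w' ⊗ 1)`. -/
abbrev trivialGamma : W ⊗[k] W →ₗ[k] W ⊗[k] (W ⊗[k] B) :=
  lTensor W ((TensorProduct.mk k W B).flip (1 : B))

variable (k B W) in
/-- `w ⊗ b ↦ w ⊗ (b ⊗ 1)`. -/
abbrev appendOne : W ⊗[k] B →ₗ[k] W ⊗[k] (B ⊗[k] B) :=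
  lTensor W ((TensorProduct.mk k B B).flip (1 : B))

theorem lrax6_id : LRax6 k (LinearMap.id : W ⊗[k] B →ₗ[k] W ⊗[k] B) := by
  intro u h h'
  simp

theorem lrax7_appendOne (h : IsMirrorBrzezinskiCrossedProduct oneW P ν) :
    LRax7 k P (appendOne k B W ∘ₗ ν) := by
  intro b w w'
  have left (x : W ⊗[k] (W ⊗[k] B)) :
      lTensor W (dR k B) (aso (rTensor B (appendOne k B W ∘ₗ ν) (osa x))) =
        appendOne k B W (lTensor W (mH k B) (aso (rTensor B ν (osa x)))) := by
    induction x with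
    | zero => simp
    | add x y hx hy => simp only [map_add, hx, hy]
    | tmul u y =>
      induction y with
      | zero => simp
      | add x y hx hy => simp only [tmul_add, map_add, hx, hy]
      | tmul v d =>
        simp only [osa_tmul, rTensor_tmul, LinearMap.comp_apply]
        induction ν (u ⊗ₜ v) with
        | zero => simp
        | add x y hx hy => simp only [add_tmul, map_add, hx, hy]
        | tmul x c => simp [dR]
  have right (x : W ⊗[k] B) :
      lTensor W (dL k B) (aso (rTensor (B ⊗[k] B) P (osa (b ⊗ₜ appendOne k B W x)))) =
        appendOne k B W (lTensor W (mH k B) (aso (rTensor B P (osa (b ⊗ₜ x))))) := by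
    induction x with
    | zero => simp
    | add x y hx hy => simp only [tmul_add, map_add, hx, hy]
    | tmul u d =>
      simp only [lTensor_tmul, LinearMap.flip_apply, TensorProduct.mk_apply, osa_tmul,
        rTensor_tmul]
      induction P (b ⊗ₜ u) with
      | zero => simp
      | add x y hx hy => simp only [add_tmul, map_add, hx, hy]
      | tmul x c => simp [dL]
  rw [left, h.compat, LinearMap.comp_apply, right]

theorem lrax8_id_appendOne :
    LRax8 k (LinearMap.id : W ⊗[k] B →ₗ[k] W ⊗[k] B) (appendOne k B W ∘ₗ ν) := by
  intro u u' b
  simp only [LinearMap.id_apply, lTensor_tmul, cc_tmul, osa_tmul, aso_tmul, rTensor_tmul,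
    rTensor_id, LinearMap.comp_apply]
  induction ν (u ⊗ₜ u') with
  | zero => simp
  | add x y hx hy => simp only [add_tmul, map_add, hx, hy]
  | tmul x c => simp [eR, eL]

theorem lrax9_id_appendOne (h : IsMirrorBrzezinskiCrossedProduct oneW P ν) :
    LRax9 k P (LinearMap.id : W ⊗[k] B →ₗ[k] W ⊗[k] B) (appendOne k B W ∘ₗ ν) := by
  intro u u' u''
  have left (x : W ⊗[k] B) :
      lTensor W (mulLR k B) (aso (rTensor (B ⊗[k] B) (appendOne k B W ∘ₗ ν)
          (osa (lTensor W (aso (P := B))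
            ((lTensor W (rTensor B P ∘ₗ osa ∘ₗ lTensor B cc ∘ₗ aso))
              (aso (appendOne k B W x ⊗ₜ u''))))))) =
        appendOne k B W (lTensor W (mH k B) (aso (rTensor B ν
          (osa (lTensor W P (aso (x ⊗ₜ u''))))))) := by
    induction x with
    | zero => simp
    | add x y hx hy => simp only [add_tmul, map_add, hx, hy]
    | tmul w b =>
      simp only [lTensor_tmul, LinearMap.flip_apply, TensorProduct.mk_apply, osa_tmul, aso_tmul,
        cc_tmul, rTensor_tmul, LinearMap.comp_apply]
      induction P (b ⊗ₜ u'') with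
      | zero => simp
      | add x y hx hy => simp only [add_tmul, tmul_add, map_add, hx, hy]
      | tmul v d =>
        simp only [aso_tmul, osa_tmul, rTensor_tmul, LinearMap.comp_apply]
        induction ν (w ⊗ₜ v) with
        | zero => simp
        | add x y hx hy => simp only [add_tmul, map_add, hx, hy]
        | tmul x c => simp [mulLR]
  have right (x : W ⊗[k] B) :
      lTensor W (mulLR k B ∘ₗ lTensor (B ⊗[k] B) cc)
          (aso (rTensor (B ⊗[k] B) (appendOne k B W ∘ₗ ν) (tt (rTensor (W ⊗[k] B) LinearMap.id
            (osa (lTensor W (lc ∘ₗ lTensor W cc) (u ⊗ₜ appendOne k B W x))))))) =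
        appendOne k B W (lTensor W (mH k B) (aso (rTensor B ν (osa (u ⊗ₜ x))))) := by
    induction x with
    | zero => simp
    | add x y hx hy => simp only [tmul_add, map_add, hx, hy]
    | tmul v d =>
      simp only [lTensor_tmul, LinearMap.flip_apply, TensorProduct.mk_apply, osa_tmul, cc_tmul,
        lc_tmul, tt_tmul, rTensor_tmul, LinearMap.comp_apply, LinearMap.id_apply]
      induction ν (u ⊗ₜ v) with
      | zero => simp
      | add x y hx hy => simp only [add_tmul, map_add, hx, hy]
      | tmul x c => simp [mulLR]
  rw [LinearMap.comp_apply, left, h.cocycle, LinearMap.comp_apply, right]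

theorem lrax10_id_trivialGamma :
    LRax10 k P (LinearMap.id : W ⊗[k] B →ₗ[k] W ⊗[k] B) (trivialGamma k B W) := by
  intro u u' b
  simp only [LinearMap.id_apply, lTensor_tmul, cc_tmul, osa_tmul, aso_tmul, rTensor_tmul,
    rTensor_id, qJ, LinearMap.comp_apply, LinearMap.flip_apply, TensorProduct.mk_apply, lc_tmul]
  induction P (b ⊗ₜ u') with
  | zero => simp
  | add x y hx hy => simp only [add_tmul, tmul_add, map_add, hx, hy]
  | tmul x c => simp

theorem lrax11_id_trivialGamma (one_P : ∀ w : W, P ((1 : B) ⊗ₜ w) = w ⊗ₜ (1 : B)) :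
    LRax11 k P (LinearMap.id : W ⊗[k] B →ₗ[k] W ⊗[k] B) (trivialGamma k B W)
      (appendOne k B W ∘ₗ ν) := by
  intro u u' u''
  simp only [LinearMap.id_apply, lTensor_tmul, cc_tmul, osa_tmul, aso_tmul, rTensor_tmul,
    tt_tmul, rTensor_id, chainX, LinearMap.comp_apply, LinearMap.flip_apply,
    TensorProduct.mk_apply, one_P]
  induction ν (u' ⊗ₜ u'') with
  | zero => simp
  | add x y hx hy => simp only [add_tmul, tmul_add, map_add, hx, hy]
  | tmul x c => simp [psi11, dR]

theorem lrax12_id_trivialGamma (one_P : ∀ w : W, P ((1 : B) ⊗ₜ w) = w ⊗ₜ (1 : B)) :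
    LRax12 k P (LinearMap.id : W ⊗[k] B →ₗ[k] W ⊗[k] B) (trivialGamma k B W)
      (appendOne k B W ∘ₗ ν) := by
  intro u u' u''
  simp only [LinearMap.id_apply, lTensor_tmul, cc_tmul, osa_tmul, rTensor_tmul,
    tt_tmul, lc_tmul, rTensor_id, LinearMap.comp_apply, LinearMap.flip_apply,
    TensorProduct.mk_apply]
  induction ν (u ⊗ₜ u') with
  | zero => simp
  | add x y hx hy => simp only [add_tmul, map_add, hx, hy]
  | tmul x c => simp [chain12, w12, big12, inner12, one_P]

theorem lrax13_id_trivialGamma :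
    LRax13 k P (LinearMap.id : W ⊗[k] B →ₗ[k] W ⊗[k] B) (trivialGamma k B W) := by
  intro u u' u'' b b'
  simp only [LinearMap.id_apply, lTensor_tmul, cc_tmul, osa_tmul, aso_tmul, rTensor_tmul,
    lc_tmul, rTensor_id, LinearMap.comp_apply, LinearMap.flip_apply,
    TensorProduct.mk_apply, w13, rhs13, xi, xi2]
  induction P (b' ⊗ₜ u') with
  | zero => simp
  | add x y hx hy => simp only [add_tmul, tmul_add, map_add, hx, hy]
  | tmul x c => simp [rho, chainR]

end MirrorToLR

/-- If `P`, `ν` satisfy the mirror Brzeziński crossed product conditions,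
then `J := P`, `T := id`, `γ(w⊗w') := w⊗w'⊗1_B`, `η(w⊗w') := ν₁(w,w')⊗ν₂(w,w')⊗1_B`
satisfy the L-R-crossed product axioms (1)-(13), with `U = W`, `1_U = 1_W` and `B` in the
role of `H`. -/
theorem mirror_brzezinski_gives_lr_crossed_product
    {k : Type*} [Field k] {B W : Type*} [Ring B] [Algebra k B]
    [AddCommGroup W] [Module k W] (oneW : W)
    (P : B ⊗[k] W →ₗ[k] W ⊗[k] B) (ν : W ⊗[k] W →ₗ[k] W ⊗[k] B)
    (hPν : IsMirrorBrzezinskiCrossedProduct oneW P ν) :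
    LRax1 k P oneW ∧
    LRax2 k (LinearMap.id : W ⊗[k] B →ₗ[k] W ⊗[k] B) oneW ∧
    LRax3 k (lTensor W ((TensorProduct.mk k W B).flip (1 : B))) oneW ∧
    LRax4 k ((lTensor W ((TensorProduct.mk k B B).flip (1 : B))) ∘ₗ ν) oneW ∧
    LRax5 k P ∧
    LRax6 k (LinearMap.id : W ⊗[k] B →ₗ[k] W ⊗[k] B) ∧
    LRax7 k P ((lTensor W ((TensorProduct.mk k B B).flip (1 : B))) ∘ₗ ν) ∧
    LRax8 k (LinearMap.id : W ⊗[k] B →ₗ[k] W ⊗[k] B)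
      ((lTensor W ((TensorProduct.mk k B B).flip (1 : B))) ∘ₗ ν) ∧
    LRax9 k P (LinearMap.id : W ⊗[k] B →ₗ[k] W ⊗[k] B)
      ((lTensor W ((TensorProduct.mk k B B).flip (1 : B))) ∘ₗ ν) ∧
    LRax10 k P (LinearMap.id : W ⊗[k] B →ₗ[k] W ⊗[k] B)
      (lTensor W ((TensorProduct.mk k W B).flip (1 : B))) ∧
    LRax11 k P (LinearMap.id : W ⊗[k] B →ₗ[k] W ⊗[k] B)
      (lTensor W ((TensorProduct.mk k W B).flip (1 : B)))
      ((lTensor W ((TensorProduct.mk k B B).flip (1 : B))) ∘ₗ ν) ∧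
    LRax12 k P (LinearMap.id : W ⊗[k] B →ₗ[k] W ⊗[k] B)
      (lTensor W ((TensorProduct.mk k W B).flip (1 : B)))
      ((lTensor W ((TensorProduct.mk k B B).flip (1 : B))) ∘ₗ ν) ∧
    LRax13 k P (LinearMap.id : W ⊗[k] B →ₗ[k] W ⊗[k] B)
      (lTensor W ((TensorProduct.mk k W B).flip (1 : B))) :=
  ⟨⟨hPν.P_one, hPν.one_P⟩, ⟨fun _ => rfl, fun _ => rfl⟩, ⟨fun _ => rfl, fun _ => rfl⟩,
    ⟨fun u => by simp [hPν.nu_one], fun u => by simp [hPν.one_nu]⟩,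
    fun h h' u => hPν.P_mul u h h', lrax6_id, lrax7_appendOne hPν, lrax8_id_appendOne,
    lrax9_id_appendOne hPν, lrax10_id_trivialGamma, lrax11_id_trivialGamma hPν.one_P,
    lrax12_id_trivialGamma hPν.one_P, lrax13_id_trivialGamma⟩
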